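/- If some agent i ∈ {1,…,N} is fanatic, then there is no protocol F = (F_1,…,F_N) in which the truthful profile (s^t,…,s^t) is an equilibrium. -/

import Mathlib

open scoped Classical
noncomputable section

/-- A strategy of an agent: `(p, q)` with `p = P(mᵢ = 0 ∣ bᵢ = 0)`, `q = P(mᵢ = 0 ∣ bᵢ = 1)`. -/
abbrev Strategy : Type := (Set.Icc (0:ℝ) 1) × (Set.Icc (0:ℝ) 1)

/-- The truthful strategy `sᵗ = (1,0)`. -/
def sT : Strategy := (⟨1, by norm_num⟩, ⟨0, by norm_num⟩)

/-- A zero-information strategy: `p = q`. -/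
def ZeroInfo (s : Strategy) : Prop := (s.1 : ℝ) = (s.2 : ℝ)

/-- Vectors of `N+1` bits (bits of the center and the `N` agents; also used for
message vectors and for the center's replies).  Coordinate `0` is the center. -/
abbrev Bits (N : ℕ) : Type := Fin (N+1) → Bool

/-- A strategy profile of the `N` agents. -/
abbrev Profile (N : ℕ) : Type := Fin N → Strategy

/-- A protocol for a single agent: a map from strategy profiles and message vectors to
distributions over replies `f ∈ {0,1}^{N+1}`. -/
abbrev Protocol (N : ℕ) : Type := Profile N → Bits N → PMF (Bits N)

/-- `P(message = msg ∣ bit = bit)` under strategy `s` (where `false` plays the role of `0`). -/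
def strandP (s : Strategy) (bit msg : Bool) : ℝ :=
  if msg then 1 - (if bit then (s.2 : ℝ) else (s.1 : ℝ))
  else (if bit then (s.2 : ℝ) else (s.1 : ℝ))

/-- `P(messages = m ∣ bits = b)` under profile `s`; the center's message is her own bit. -/
def msgP {N : ℕ} (s : Profile N) (b m : Bits N) : ℝ :=
  (if m 0 = b 0 then (1:ℝ) else 0) * ∏ i : Fin N, strandP (s i) (b i.succ) (m i.succ)

/-- Joint probability of bits `b`, messages `m` and reply `f` (to the relevant agent),
under profile `s` and protocol `F`; bits are i.i.d. uniform. -/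
def jointP {N : ℕ} (s : Profile N) (F : Protocol N) (b m f : Bits N) : ℝ :=
  ((1:ℝ)/2)^(N+1) * msgP s b m * ((F s m) f).toReal

/-- `P(bᵢ = bi, mᵢ = mi, fᵢ = f, g(b) = val)` for agent `i` (coordinate `i.succ`). -/
def pObs {N : ℕ} (g : Bits N → Bool) (s : Profile N) (F : Protocol N) (i : Fin N)
    (bi mi : Bool) (f : Bits N) (val : Bool) : ℝ :=
  ∑ b : Bits N, ∑ m : Bits N,
    if b i.succ = bi ∧ m i.succ = mi ∧ g b = val then jointP s F b m f else 0

/-- `P(bᵢ = bi, mᵢ = mi, fᵢ = f)` for agent `i`. -/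
def pObsAll {N : ℕ} (s : Profile N) (F : Protocol N) (i : Fin N)
    (bi mi : Bool) (f : Bits N) : ℝ :=
  ∑ b : Bits N, ∑ m : Bits N,
    if b i.succ = bi ∧ m i.succ = mi then jointP s F b m f else 0

/-- `P(b_k = 1, bᵢ = bi, mᵢ = mi, fᵢ = f)` for agent `i`. -/
def pBit {N : ℕ} (s : Profile N) (F : Protocol N) (i : Fin N)
    (bi mi : Bool) (f : Bits N) (k : Fin (N+1)) : ℝ :=
  ∑ b : Bits N, ∑ m : Bits N,
    if b i.succ = bi ∧ m i.succ = mi ∧ b k = true then jointP s F b m f else 0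

/-- The posterior `v_k = P(b_k = 1 ∣ fᵢ, mᵢ, bᵢ)` of agent `i` at the realization
`(bi, mi, f)`. -/
def post {N : ℕ} (s : Profile N) (F : Protocol N) (i : Fin N)
    (bi mi : Bool) (f : Bits N) (k : Fin (N+1)) : ℝ :=
  pBit s F i bi mi f k / pObsAll s F i bi mi f

/-- Expected profit `V_i(s⃗; F_i)`: after observing `(bᵢ, mᵢ, fᵢ)` the agent guesses the
more likely value of `g(b)` (uniformly at random in case of a tie) and earns `c i` iff
the guess is correct. -/
def V {N : ℕ} (g : Bits N → Bool) (c : Fin N → ℝ) (s : Profile N) (F : Protocol N)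
    (i : Fin N) : ℝ :=
  c i * ∑ bi : Bool, ∑ mi : Bool, ∑ f : Bits N,
    (if pObs g s F i bi mi f true > pObs g s F i bi mi f false then pObs g s F i bi mi f true
     else if pObs g s F i bi mi f false > pObs g s F i bi mi f true then
       pObs g s F i bi mi f false
     else (pObs g s F i bi mi f false + pObs g s F i bi mi f true) / 2)

/-- Utility `U_i(s⃗; F_i) = V_i(s⃗; F_i) − priceᵢ(sᵢ)`. -/
def U {N : ℕ} (g : Bits N → Bool) (c : Fin N → ℝ) (price : Fin N → Strategy → ℝ)
    (s : Profile N) (F : Protocol N) (i : Fin N) : ℝ :=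
  V g c s F i - price i (s i)

/-- The all-truthful profile `(sᵗ, …, sᵗ)`. -/
def truthProfile (N : ℕ) : Profile N := fun _ => sT

/-- `s⃗` is an equilibrium of the protocol `F = (F_1,…,F_N)`. -/
def Equilibrium {N : ℕ} (g : Bits N → Bool) (c : Fin N → ℝ) (price : Fin N → Strategy → ℝ)
    (s : Profile N) (FF : Fin N → Protocol N) : Prop :=
  ∀ i : Fin N, ∀ s' : Strategy,
    U g c price s (FF i) i ≥ U g c price (Function.update s i s') (FF i) i

/-- The improvement `F_i⁺` of a protocol `F_i`: it agrees with `F_i` when `s_i` is a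
zero-information strategy, and otherwise returns the reply whose first coordinate is
`m₀ = b₀` and whose remaining coordinates are those of `F_i`'s reply. -/
def improve {N : ℕ} (i : Fin N) (F : Protocol N) : Protocol N := fun s m =>
  if ZeroInfo (s i) then F s m
  else PMF.map (fun f => Function.update f 0 (m 0)) (F s m)

/-- The center is helpless. -/
def Helpless (N : ℕ) (g : Bits N → Bool) (c : Fin N → ℝ)
    (price : Fin N → Strategy → ℝ) : Prop :=
  ∀ i : Fin N, ∀ F : Protocol N, ∀ si : Strategy, ¬ ZeroInfo si →
    ∀ sr : Profile N, (∀ j, ZeroInfo (sr j)) →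
      U g c price sr F i ≥ U g c price (Function.update sr i si) (improve i F) i

/-- Relative price `price_i^r(s_i) = price_i(s_i) / price_i(sᵗ)`. -/
def priceR {N : ℕ} (price : Fin N → Strategy → ℝ) (i : Fin N) (s : Strategy) : ℝ :=
  price i s / price i sT

/-- The competitive protocol (the component `F_i^c` for agent `i`). -/
def Fc {N : ℕ} (price : Fin N → Strategy → ℝ) (i : Fin N) : Protocol N := fun s m =>
  if ∀ j, s j = sT then PMF.pure m
  else if ∀ j, j ≠ i → priceR price j (s j) < priceR price i (s i) then PMF.pure m
  else PMF.uniformOfFintype (Bits N)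

/-- The protocol that always replies the full message vector `m = (b₀, m₁, …, m_N)`. -/
def Fmax (N : ℕ) : Protocol N := fun _ m => PMF.pure m

/-- The protocol that always replies `N+1` independent uniform random bits. -/
def Fmin (N : ℕ) : Protocol N := fun _ _ => PMF.uniformOfFintype (Bits N)

/-- Agent `i` is fanatic. -/
def Fanatic {N : ℕ} (g : Bits N → Bool) (c : Fin N → ℝ) (price : Fin N → Strategy → ℝ)
    (i : Fin N) : Prop :=
  ∀ s : Profile N,
    price i sT > V g c (truthProfile N) (Fmax N) i - V g c s (Fmin N) i

/-- The fair competitive protocol (the component `F_i^{fc}` for agent `i`). -/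
def Ffc {N : ℕ} (price : Fin N → Strategy → ℝ) (i : Fin N) : Protocol N := fun s m =>
  if s i = sT then PMF.pure m
  else if (∃ j, j ≠ i ∧ s j ≠ sT) ∧
      (∀ j, j ≠ i → s j ≠ sT → priceR price j (s j) < priceR price i (s i)) then PMF.pure m
  else PMF.uniformOfFintype (Bits N)

theorem strandP_nonneg (s : Strategy) (bit msg : Bool) : 0 ≤ strandP s bit msg := by
  obtain ⟨hp0, hp1⟩ := s.1.2
  obtain ⟨hq0, hq1⟩ := s.2.2
  unfold strandP
  split_ifs <;> linarith

theorem jointP_nonneg {N : ℕ} (s : Profile N) (F : Protocol N) (b m f : Bits N) :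
    0 ≤ jointP s F b m f := by
  unfold jointP msgP
  refine mul_nonneg (mul_nonneg (by positivity) (mul_nonneg ?_ ?_)) ENNReal.toReal_nonneg
  · split_ifs <;> norm_num
  · exact Finset.prod_nonneg fun i _ => strandP_nonneg _ _ _

theorem pObs_nonneg {N : ℕ} (g : Bits N → Bool) (s : Profile N) (F : Protocol N) (i : Fin N)
    (bi mi : Bool) (f : Bits N) (val : Bool) : 0 ≤ pObs g s F i bi mi f val := by
  refine Finset.sum_nonneg fun b _ => Finset.sum_nonneg fun m _ => ?_
  split_ifs
  exacts [jointP_nonneg s F b m f, le_rfl]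

/-- `P(bᵢ = bi, mᵢ = mi, g(b) = val)`: the law of what agent `i` sees before any reply. -/
def pNoReply {N : ℕ} (g : Bits N → Bool) (s : Profile N) (i : Fin N) (bi mi val : Bool) : ℝ :=
  ∑ b : Bits N, ∑ m : Bits N,
    if b i.succ = bi ∧ m i.succ = mi ∧ g b = val then ((1:ℝ)/2)^(N+1) * msgP s b m else 0

theorem PMF.sum_toReal_eq_one {α : Type*} [Fintype α] (p : PMF α) :
    ∑ a, (p a).toReal = 1 := by
  rw [← ENNReal.toReal_sum fun a _ => p.apply_ne_top a, ← tsum_fintype (L := .unconditional α),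
    p.tsum_coe, ENNReal.toReal_one]

theorem sum_pObs {N : ℕ} (g : Bits N → Bool) (s : Profile N) (F : Protocol N) (i : Fin N)
    (bi mi val : Bool) : ∑ f, pObs g s F i bi mi f val = pNoReply g s i bi mi val := by
  unfold pObs pNoReply
  rw [Finset.sum_comm]
  refine Finset.sum_congr rfl fun b _ => ?_
  rw [Finset.sum_comm]
  refine Finset.sum_congr rfl fun m _ => ?_
  split_ifs
  · simp only [jointP]
    rw [← Finset.mul_sum, PMF.sum_toReal_eq_one, mul_one]
  · simp

theorem pObs_Fmin {N : ℕ} (g : Bits N → Bool) (s : Profile N) (i : Fin N)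
    (bi mi : Bool) (f : Bits N) (val : Bool) :
    pObs g s (Fmin N) i bi mi f val =
      pNoReply g s i bi mi val * (Fintype.card (Bits N) : ℝ)⁻¹ := by
  unfold pObs pNoReply
  rw [Finset.sum_mul]
  refine Finset.sum_congr rfl fun b _ => ?_
  rw [Finset.sum_mul]
  refine Finset.sum_congr rfl fun m _ => ?_
  split_ifs
  · simp only [jointP, Fmin, PMF.uniformOfFintype_apply, ENNReal.toReal_inv,
      ENNReal.toReal_natCast]
  · simp

theorem V_eq_sum_max {N : ℕ} (g : Bits N → Bool) (c : Fin N → ℝ) (s : Profile N)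
    (F : Protocol N) (i : Fin N) :
    V g c s F i = c i * ∑ bi : Bool, ∑ mi : Bool, ∑ f : Bits N,
      max (pObs g s F i bi mi f false) (pObs g s F i bi mi f true) := by
  unfold V
  congr 1
  refine Finset.sum_congr rfl fun bi _ => Finset.sum_congr rfl fun mi _ =>
    Finset.sum_congr rfl fun f _ => ?_
  split_ifs with h1 h2
  · exact (max_eq_right h1.le).symm
  · exact (max_eq_left h2.le).symm
  · rw [le_antisymm (not_lt.1 h1) (not_lt.1 h2)]
    simp

theorem V_Fmin_le {N : ℕ} (g : Bits N → Bool) (c : Fin N → ℝ) (s : Profile N)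
    (F : Protocol N) (i : Fin N) (hc : 0 ≤ c i) : V g c s (Fmin N) i ≤ V g c s F i := by
  rw [V_eq_sum_max, V_eq_sum_max]
  refine mul_le_mul_of_nonneg_left (Finset.sum_le_sum fun bi _ => Finset.sum_le_sum fun mi _ => ?_)
    hc
  calc ∑ f, max (pObs g s (Fmin N) i bi mi f false) (pObs g s (Fmin N) i bi mi f true)
      = max (pNoReply g s i bi mi false) (pNoReply g s i bi mi true) := by
        simp only [pObs_Fmin]
        rw [← max_mul_of_nonneg _ _ (by positivity), Finset.sum_const, Finset.card_univ,
          nsmul_eq_mul]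
        field_simp
    _ ≤ _ := by
        rw [← sum_pObs g s F, ← sum_pObs g s F]
        exact max_le (Finset.sum_le_sum fun f _ => le_max_left _ _)
          (Finset.sum_le_sum fun f _ => le_max_right _ _)

theorem V_le_sum_pNoReply {N : ℕ} (g : Bits N → Bool) (c : Fin N → ℝ) (s : Profile N)
    (F : Protocol N) (i : Fin N) (hc : 0 ≤ c i) :
    V g c s F i ≤ c i * ∑ bi : Bool, ∑ mi : Bool,
      (pNoReply g s i bi mi false + pNoReply g s i bi mi true) := by
  rw [V_eq_sum_max]
  refine mul_le_mul_of_nonneg_left (Finset.sum_le_sum fun bi _ => Finset.sum_le_sum fun mi _ => ?_)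
    hc
  rw [← sum_pObs g s F, ← sum_pObs g s F, ← Finset.sum_add_distrib]
  exact Finset.sum_le_sum fun f _ =>
    max_le_add_of_nonneg (pObs_nonneg ..) (pObs_nonneg ..)

theorem strandP_sT_of_ne {bit msg : Bool} (h : msg ≠ bit) : strandP sT bit msg = 0 := by
  cases bit <;> cases msg <;> simp_all [strandP, sT]

theorem msgP_truthProfile_of_ne {N : ℕ} {b m : Bits N} (h : m ≠ b) :
    msgP (truthProfile N) b m = 0 := by
  obtain ⟨k, hk⟩ := Function.ne_iff.1 h
  unfold msgP
  cases k using Fin.cases with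
  | zero => simp [hk]
  | succ j =>
    rw [Finset.prod_eq_zero (Finset.mem_univ j) (strandP_sT_of_ne hk), mul_zero]

theorem jointP_truthProfile_Fmax_of_ne {N : ℕ} {b m f : Bits N} (h : b ≠ f) :
    jointP (truthProfile N) (Fmax N) b m f = 0 := by
  unfold jointP Fmax
  by_cases hm : m = b
  · subst hm
    simp [PMF.pure_apply, h.symm]
  · simp [msgP_truthProfile_of_ne hm]

theorem pObs_truthProfile_Fmax_of_ne {N : ℕ} (g : Bits N → Bool) (i : Fin N)
    (bi mi : Bool) {f : Bits N} {val : Bool} (h : g f ≠ val) :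
    pObs g (truthProfile N) (Fmax N) i bi mi f val = 0 := by
  refine Finset.sum_eq_zero fun b _ => Finset.sum_eq_zero fun m _ => ?_
  split_ifs with hb
  · exact jointP_truthProfile_Fmax_of_ne fun hbf => h (hbf ▸ hb.2.2)
  · rfl

theorem V_truthProfile_Fmax {N : ℕ} (g : Bits N → Bool) (c : Fin N → ℝ) (i : Fin N) :
    V g c (truthProfile N) (Fmax N) i = c i * ∑ bi : Bool, ∑ mi : Bool,
      (pNoReply g (truthProfile N) i bi mi false + pNoReply g (truthProfile N) i bi mi true) := by
  rw [V_eq_sum_max]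
  congr 1
  refine Finset.sum_congr rfl fun bi _ => Finset.sum_congr rfl fun mi _ => ?_
  rw [← sum_pObs g _ (Fmax N), ← sum_pObs g _ (Fmax N), ← Finset.sum_add_distrib]
  refine Finset.sum_congr rfl fun f _ => ?_
  cases hg : g f
  · rw [pObs_truthProfile_Fmax_of_ne (val := true) g i bi mi (by simp [hg]), add_zero]
    exact max_eq_left (pObs_nonneg ..)
  · rw [pObs_truthProfile_Fmax_of_ne (val := false) g i bi mi (by simp [hg]), zero_add]
    exact max_eq_right (pObs_nonneg ..)

/-- a fanatic agent precludes any truthful equilibrium. -/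
theorem fanatic_no_truthful_equilibrium (N : ℕ) (hN : 2 ≤ N) (g : Bits N → Bool) (c : Fin N → ℝ)
    (hc : ∀ i, 0 < c i)
    (price : Fin N → Strategy → ℝ)
    (hpriceCont : ∀ i, Continuous (price i))
    (hprice0 : ∀ i s, ZeroInfo s → price i s = 0)
    (hpricePos : ∀ i s, ¬ ZeroInfo s → 0 < price i s)
    (hpriceMax : ∀ i s, price i s ≤ price i sT)
    (i : Fin N) (hf : Fanatic g c price i) :
    ¬ ∃ FF : Fin N → Protocol N, Equilibrium g c price (truthProfile N) FF := by
  rintro ⟨FF, hE⟩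
  have hdev := hE i (1, 1)
  have hlow := V_Fmin_le g c (Function.update (truthProfile N) i (1, 1)) (FF i) i (hc i).le
  have hup := V_le_sum_pNoReply g c (truthProfile N) (FF i) i (hc i).le
  rw [← V_truthProfile_Fmax] at hup
  have hfan := hf (Function.update (truthProfile N) i (1, 1))
  have hprice : price i (1, 1) = 0 := hprice0 i _ rfl
  simp only [U, Function.update_self, hprice] at hdev
  change _ - price i sT ≥ _ at hdev
  linarith

end
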